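/- arXiv:2512.10220 — 5 statements merged into one kernel-verified Lean document; each statement's English description precedes it below -/
import Mathlib

section
/- Let d ≥ 1 and n ≥ d be integers. Let Y_1, …, Y_n be i.i.d. standard Gaussian random vectors in ℝ^d and let W := ∑_{i=1}^n Y_i Y_iᵀ (so W is a Wishart_d(n, I_d) matrix). Then E[ log det W ] = d·log 2 + ∑_{j=1}^d ψ((n−j+1)/2). -/
open MeasureTheory ProbabilityTheory Matrix

/-- The digamma function `ψ(x) = (log Γ)'(x)`. -/
noncomputable def digamma (x : ℝ) : ℝ := deriv (fun t => Real.log (Real.Gamma t)) x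

/-- The law of `n` i.i.d. standard Gaussian vectors in `ℝ^d`. -/
noncomputable def stdGaussianSample (n d : ℕ) : Measure (Fin n → Fin d → ℝ) :=
  Measure.pi fun _ => Measure.pi fun _ => gaussianReal 0 1

/-- Wishart matrix `W = ∑_{i=1}^n Y_i Y_iᵀ`. -/
noncomputable def wishart (n d : ℕ) (Y : Fin n → Fin d → ℝ) :
    Matrix (Fin d) (Fin d) ℝ :=
  ∑ i : Fin n, vecMulVec (Y i) (Y i)


lemma det_gram_cons {E : Type*} [NormedAddCommGroup E] [InnerProductSpace ℝ E]
    [FiniteDimensional ℝ E] {d : ℕ} (u : E) (v : Fin d → E) :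
    (gram ℝ (Fin.cons u v : Fin (d+1) → E)).det =
      ‖(Submodule.span ℝ (Set.range v))ᗮ.orthogonalProjectionOnto u‖ ^ 2 * (gram ℝ v).det := by
  set S := Submodule.span ℝ (Set.range v) with hS
  set w : E := (Sᗮ.orthogonalProjectionOnto u : E) with hw
  have hmem : u - w ∈ S := by
    have := Sᗮ.sub_starProjection_mem_orthogonal u
    rw [Submodule.orthogonal_orthogonal] at this
    exact this
  have hwS : w ∈ Sᗮ := (Sᗮ.orthogonalProjectionOnto u).2
  have hwv : ∀ j, inner ℝ w (v j) = 0 := fun j =>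
    (Submodule.mem_orthogonal' S w).1 hwS _ (Submodule.subset_span ⟨j, rfl⟩)
  have hwu : inner ℝ w u = ‖w‖ ^ 2 := by
    have : inner ℝ w (u - w) = 0 := (Submodule.mem_orthogonal' S w).1 hwS _ hmem
    rw [inner_sub_right, real_inner_self_eq_norm_sq] at this
    linarith
  obtain ⟨c, hc⟩ := (Submodule.mem_span_range_iff_exists_fun ℝ).1 hmem
  set G := gram ℝ (Fin.cons u v : Fin (d+1) → E) with hG
  have h1 := Matrix.det_updateRow_sum G 0 (Fin.cons 1 (fun j => - c j) : Fin (d+1) → ℝ)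
  simp only [Fin.cons_zero, one_smul] at h1
  have hrow : (∑ k, (Fin.cons 1 (fun j => - c j) : Fin (d+1) → ℝ) k • G k) =
      (Fin.cons (‖w‖ ^ 2) (fun _ => 0) : Fin (d+1) → ℝ) := by
    have key : ∀ z, inner ℝ u z + ∑ k, -(c k * inner ℝ (v k) z) = inner ℝ w z := by
      intro z
      have : w = u - ∑ k, c k • v k := by rw [hc]; abel
      rw [this, inner_sub_left, sum_inner]
      simp only [real_inner_smul_left, Finset.sum_neg_distrib]
      ring
    rw [Fin.sum_univ_succ]
    ext j
    have := key ((Fin.cons u v : Fin (d+1) → E) j)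
    simp only [Fin.cons_zero, Fin.cons_succ, one_smul, Pi.add_apply, Finset.sum_apply,
      Pi.smul_apply, hG, gram_apply, smul_eq_mul, neg_mul]
    rw [this]
    refine Fin.cases ?_ (fun j => ?_) j
    · simpa using hwu
    · simpa using hwv j
  rw [← h1, hrow, Matrix.det_succ_row_zero, Fin.sum_univ_succ]
  simp only [Matrix.updateRow_self, Fin.cons_zero, Fin.cons_succ]
  have : (G.updateRow 0 (Fin.cons (‖w‖ ^ 2) (fun _ => 0) : Fin (d+1) → ℝ)).submatrix Fin.succ
      (Fin.succAbove 0) = gram ℝ v := by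
    ext i j
    simp [Matrix.updateRow_apply, hG, gram_apply]
  rw [this]
  simp [hw]

/-- law of the squared norm of a standard Gaussian -/
noncomputable def chiSqLaw (k : ℕ) : Measure ℝ :=
  (stdGaussian (EuclideanSpace ℝ (Fin k))).map (fun x => ‖x‖ ^ 2)

lemma map_proj_stdGaussian {E : Type*} [NormedAddCommGroup E] [InnerProductSpace ℝ E]
    [FiniteDimensional ℝ E] [MeasurableSpace E] [BorelSpace E] (K : Submodule ℝ E) :
    (stdGaussian E).map K.orthogonalProjectionOnto = stdGaussian K := by
  apply Measure.ext_of_charFun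
  ext t
  rw [charFun_stdGaussian, charFun_apply, integral_map (by fun_prop)
    (Measurable.aestronglyMeasurable (by fun_prop))]
  have := charFun_stdGaussian (E := E) (t : E)
  rw [charFun_apply] at this
  simpa using this

lemma map_norm_proj {E : Type*} [NormedAddCommGroup E] [InnerProductSpace ℝ E]
    [FiniteDimensional ℝ E] [MeasurableSpace E] [BorelSpace E] (K : Submodule ℝ E) {k : ℕ}
    (hk : Module.finrank ℝ K = k) :
    (stdGaussian E).map (fun x => ‖K.orthogonalProjectionOnto x‖ ^ 2) = chiSqLaw k := by
  have h1 : (stdGaussian E).map (fun x => ‖K.orthogonalProjectionOnto x‖ ^ 2) =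
      (stdGaussian K).map (fun x => ‖x‖ ^ 2) := by
    rw [← map_proj_stdGaussian K, Measure.map_map (by fun_prop) (by fun_prop)]
    rfl
  let b := (stdOrthonormalBasis ℝ K).reindex (finCongr hk)
  rw [h1, chiSqLaw, ← stdGaussian_map b.repr, Measure.map_map (by fun_prop) (by fun_prop)]
  congr 1
  ext x
  simp

lemma stdGaussian_density (k : ℕ) : ∃ c : ℝ, 0 < c ∧
    stdGaussian (EuclideanSpace ℝ (Fin k)) =
    (volume : Measure (EuclideanSpace ℝ (Fin k))).withDensity
      (fun x => ENNReal.ofReal (c * Real.exp (-‖x‖ ^ 2 / 2))) := by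
  set E := EuclideanSpace ℝ (Fin k)
  have hb : (0:ℝ) < (1/2 : ℂ).re := by norm_num
  have hint := GaussianFourier.integrable_cexp_neg_mul_sq_norm_add (V := E) hb 0 0
  have hI : Integrable (fun x : E => Real.exp (-‖x‖ ^ 2 / 2)) := by
    have := hint.norm
    refine this.congr (Filter.Eventually.of_forall fun x => ?_)
    simp only [Complex.norm_exp]
    congr 1
    simp [← Complex.ofReal_pow]
    ring
  set c : ℝ := ((2 * Real.pi) ^ ((k:ℝ) / 2))⁻¹ with hc
  have hcpos : 0 < c := by positivity
  refine ⟨c, hcpos, ?_⟩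
  have : IsFiniteMeasure ((volume : Measure E).withDensity
      (fun x => ENNReal.ofReal (c * Real.exp (-‖x‖ ^ 2 / 2)))) :=
    isFiniteMeasure_withDensity_ofReal (hI.const_mul c).2
  apply Measure.ext_of_charFun
  ext t
  rw [charFun_stdGaussian, charFun_apply,
    integral_withDensity_eq_integral_toReal_smul (by fun_prop) (by simp)]
  have h2 := GaussianFourier.integral_cexp_neg_mul_sq_norm_add (V := E) hb Complex.I t
  have : ∀ x : E, (ENNReal.ofReal (c * Real.exp (-‖x‖ ^ 2 / 2))).toReal •
      Complex.exp (inner ℝ x t * Complex.I) =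
      (c : ℂ) * Complex.exp (-(1/2 : ℂ) * ‖x‖ ^ 2 + Complex.I * (inner ℝ t x : ℝ)) := by
    intro x
    rw [ENNReal.toReal_ofReal (by positivity), Complex.real_smul, Complex.exp_add,
      real_inner_comm]
    push_cast
    rw [show -(1/2 : ℂ) * ‖x‖ ^ 2 = -‖x‖ ^ 2 / 2 by ring, mul_comm Complex.I]
    ring
  simp_rw [this]
  rw [integral_const_mul, h2]
  have h3 : ((Real.pi : ℂ) / (1/2)) ^ ((Module.finrank ℝ E : ℂ) / 2) =
      (((2 * Real.pi) ^ ((k:ℝ) / 2) : ℝ) : ℂ) := by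
    rw [Complex.ofReal_cpow (by positivity)]
    simp [E]
    ring_nf
  rw [h3, ← mul_assoc, ← Complex.ofReal_mul, hc, inv_mul_cancel₀ (by positivity)]
  simp
  ring_nf

lemma radial_change (k : ℕ) (hk : 1 ≤ k) (f : ℝ → ℝ) :
    (∫ r in Set.Ioi (0:ℝ), r ^ (k-1) * (Real.exp (-r^2/2) * f (r^2)) =
      2 ^ ((k:ℝ)/2 - 1) * ∫ t in Set.Ioi (0:ℝ), t ^ ((k:ℝ)/2-1) * (Real.exp (-t) * f (2*t))) ∧
    (IntegrableOn (fun t => t ^ ((k:ℝ)/2-1) * (Real.exp (-t) * f (2*t))) (Set.Ioi 0) →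
      IntegrableOn (fun r => r ^ (k-1) * (Real.exp (-r^2/2) * f (r^2))) (Set.Ioi 0)) := by
  set a := (k:ℝ)/2 with ha
  set g : ℝ → ℝ := fun t => t ^ (a-1) * (Real.exp (-t) * f (2*t)) with hg
  set h : ℝ → ℝ := fun u => g (1/2 * u) with hh
  have e1 : ∫ u in Set.Ioi (0:ℝ), h u = 2 * ∫ t in Set.Ioi (0:ℝ), g t := by
    have := integral_comp_mul_left_Ioi g 0 (b := 1/2) (by norm_num)
    rw [hh, this]; simp
  have e2 := integral_comp_rpow_Ioi_of_pos (g := h) (p := 2) (by norm_num)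
  have key : Set.EqOn (fun r : ℝ => r ^ (k-1) * (Real.exp (-r^2/2) * f (r^2)))
      (fun r => (2 ^ (a-1) / 2) * ((2 * r ^ ((2:ℝ)-1)) • h (r ^ (2:ℝ)))) (Set.Ioi 0) := by
    intro r hr
    have hr : 0 < r := hr
    simp only [hh, hg, smul_eq_mul]
    have h1 : (1/2 * r ^ (2:ℝ)) ^ (a-1) = (2 ^ (a-1))⁻¹ * r ^ (2 * (a - 1)) := by
      rw [Real.mul_rpow (by norm_num) (by positivity), ← Real.rpow_mul hr.le, one_div,
        Real.inv_rpow (by norm_num)]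
    have h2 : r ^ (k-1) = r ^ (2 * (a - 1)) * r ^ ((2:ℝ)-1) := by
      rw [← Real.rpow_add hr, ← Real.rpow_natCast, Nat.cast_sub hk, ha]
      congr 1; push_cast; ring
    rw [h1, h2]
    rw [Real.rpow_two]
    have h3 : (2:ℝ) ^ (a-1) ≠ 0 := by positivity
    rw [show 2 * (1/2 * r^2) = r^2 by ring, show -(1/2 * r^2) = -r^2/2 by ring]
    field_simp
  constructor
  · rw [setIntegral_congr_fun measurableSet_Ioi key, integral_const_mul, e2, e1]
    ring
  · intro hi
    rw [integrableOn_congr_fun key measurableSet_Ioi]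
    apply Integrable.const_mul
    have := (integrableOn_Ioi_comp_rpow_iff h (p := 2) (by norm_num)).2 (by
      have := (integrableOn_Ioi_comp_mul_left_iff g 0 (a := 1/2) (by norm_num)).2 (by simpa using hi)
      exact this)
    simpa [IntegrableOn] using this

lemma gamma_log {a : ℝ} (ha : 0 < a) :
    IntegrableOn (fun t => t ^ (a-1) * (Real.exp (-t) * Real.log t)) (Set.Ioi 0) ∧
    HasDerivAt Real.Gamma (∫ t in Set.Ioi (0:ℝ), t ^ (a-1) * (Real.exp (-t) * Real.log t)) a := by
  have hs : 0 < (a : ℂ).re := by simpa using ha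
  have hM := (mellin_hasDerivAt_of_isBigO_rpow (E := ℂ) (f := fun t : ℝ => ((Real.exp (-t) : ℝ) : ℂ))
    (s := a) (a := (a:ℂ).re + 1) (b := 0) (by
      refine (Continuous.continuousOn ?_).locallyIntegrableOn measurableSet_Ioi
      fun_prop) (by
      rw [← Asymptotics.isBigO_norm_left]
      simp_rw [Complex.norm_real, Asymptotics.isBigO_norm_left]
      simpa only [neg_one_mul] using (isLittleO_exp_neg_mul_rpow_atTop zero_lt_one _).isBigO)
    (lt_add_one _) (by
      simp_rw [neg_zero, Real.rpow_zero]
      refine Asymptotics.isBigO_const_of_tendsto (?_ : Filter.Tendsto _ _ (nhds (1 : ℂ))) one_ne_zero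
      rw [(by simp : (1 : ℂ) = Real.exp (-0))]
      exact (Complex.continuous_ofReal.comp
        (Real.continuous_exp.comp continuous_neg)).continuousWithinAt) hs).1
  have hcast : Set.EqOn (fun t : ℝ => (t:ℂ) ^ ((a:ℂ) - 1) * ((Real.log t : ℂ) * (Real.exp (-t) : ℂ)))
      (fun t => ((t ^ (a-1) * (Real.exp (-t) * Real.log t) : ℝ) : ℂ)) (Set.Ioi 0) := by
    intro t ht
    have ht : 0 < t := ht
    simp only
    push_cast
    rw [Complex.ofReal_cpow ht.le]
    push_cast
    ring
  constructor
  · have h1 : IntegrableOn (fun t : ℝ => ((t ^ (a-1) * (Real.exp (-t) * Real.log t) : ℝ) : ℂ))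
        (Set.Ioi 0) := by
      rw [← integrableOn_congr_fun hcast measurableSet_Ioi]
      simpa [MellinConvergent] using hM
    exact h1.re
  · have hd := Complex.hasDerivAt_GammaIntegral hs
    rw [setIntegral_congr_fun measurableSet_Ioi hcast, integral_complex_ofReal] at hd
    have hd' : HasDerivAt Complex.Gamma
        ((∫ t in Set.Ioi (0:ℝ), t ^ (a-1) * (Real.exp (-t) * Real.log t) : ℝ) : ℂ) a := by
      apply hd.congr_of_eventuallyEq
      have : IsOpen {s : ℂ | 0 < s.re} := Complex.continuous_re.isOpen_preimage _ isOpen_Ioi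
      filter_upwards [this.mem_nhds hs] with z hz using Complex.Gamma_eq_integral hz
    exact hd'.real_of_complex

lemma log_deriv_digamma {a : ℝ} (ha : 0 < a) :
    digamma a * Real.Gamma a =
      ∫ t in Set.Ioi (0:ℝ), t ^ (a-1) * (Real.exp (-t) * Real.log t) := by
  have hG := (Real.Gamma_pos_of_pos ha).ne'
  rw [digamma, ((gamma_log ha).2.log hG).deriv]
  field_simp

lemma chiSq_expect (k : ℕ) (hk : 1 ≤ k) : ∃ C : ℝ, ∀ f : ℝ → ℝ, Measurable f →
    (∫ y, f y ∂(chiSqLaw k) =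
      C * ∫ t in Set.Ioi (0:ℝ), t ^ ((k:ℝ)/2-1) * (Real.exp (-t) * f (2*t))) ∧
    (IntegrableOn (fun t => t ^ ((k:ℝ)/2-1) * (Real.exp (-t) * f (2*t))) (Set.Ioi 0) →
      Integrable f (chiSqLaw k)) := by
  obtain ⟨c, hc, hden⟩ := stdGaussian_density k
  have : Nonempty (Fin k) := ⟨⟨0, hk⟩⟩
  set E := EuclideanSpace ℝ (Fin k) with hE
  have hfr : Module.finrank ℝ E = k := finrank_euclideanSpace_fin
  refine ⟨c * (k * (volume : Measure E).real (Metric.ball 0 1) * 2 ^ ((k:ℝ)/2 - 1)),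
    fun f hf => ?_⟩
  have hpt : ∀ x : E, (ENNReal.ofReal (c * Real.exp (-‖x‖ ^ 2 / 2))).toReal • f (‖x‖ ^ 2) =
      c * (fun r => Real.exp (-r ^ 2 / 2) * f (r ^ 2)) ‖x‖ := by
    intro x
    rw [ENNReal.toReal_ofReal (by positivity), smul_eq_mul, mul_assoc]
  obtain ⟨r1, r2⟩ := radial_change k hk f
  constructor
  · rw [chiSqLaw, integral_map (by fun_prop) hf.aestronglyMeasurable, hden,
      integral_withDensity_eq_integral_toReal_smul (by fun_prop) (by simp)]
    simp_rw [hpt]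
    rw [integral_const_mul, integral_fun_norm_addHaar (volume : Measure E)
      (fun r => Real.exp (-r ^ 2 / 2) * f (r ^ 2)), hfr]
    simp only [smul_eq_mul, nsmul_eq_mul]
    rw [r1]
    ring
  · intro hi
    rw [chiSqLaw, integrable_map_measure hf.aestronglyMeasurable (by fun_prop), hden,
      integrable_withDensity_iff_integrable_smul' (by fun_prop) (by simp)]
    simp only [Function.comp_def]
    simp_rw [hpt]
    apply Integrable.const_mul
    rw [integrable_fun_norm_addHaar (volume : Measure E)
      (f := fun r => Real.exp (-r ^ 2 / 2) * f (r ^ 2)), hfr]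
    exact r2 hi

instance chiSq_prob (k : ℕ) : IsProbabilityMeasure (chiSqLaw k) :=
  Measure.isProbabilityMeasure_map (by fun_prop)

lemma chiSq_ne_zero (k : ℕ) (hk : 1 ≤ k) : ∀ᵐ y ∂(chiSqLaw k), y ≠ 0 := by
  have : Nonempty (Fin k) := ⟨⟨0, hk⟩⟩
  rw [chiSqLaw, ae_map_iff (by fun_prop) (by measurability)]
  obtain ⟨c, hc, hden⟩ := stdGaussian_density k
  rw [hden]
  apply (withDensity_absolutelyContinuous _ _).ae_le
  have : ∀ᵐ x : EuclideanSpace ℝ (Fin k), x ≠ 0 := by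
    simp [ae_iff]
  filter_upwards [this] with x hx
  simpa using hx

lemma chiSq_log (k : ℕ) (hk : 1 ≤ k) : Integrable Real.log (chiSqLaw k) ∧
    ∫ y, Real.log y ∂(chiSqLaw k) = Real.log 2 + digamma ((k:ℝ)/2) := by
  have ha : (0:ℝ) < (k:ℝ)/2 := by positivity
  obtain ⟨C, hC⟩ := chiSq_expect k hk
  have h1 := (hC (fun _ => 1) measurable_const).1
  have hGi : IntegrableOn (fun t : ℝ => t ^ ((k:ℝ)/2-1) * Real.exp (-t)) (Set.Ioi 0) := by
    simpa [mul_comm] using Real.GammaIntegral_convergent ha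
  have hGe : ∫ t in Set.Ioi (0:ℝ), t ^ ((k:ℝ)/2-1) * Real.exp (-t) = Real.Gamma ((k:ℝ)/2) := by
    rw [Real.Gamma_eq_integral ha]; simp_rw [mul_comm]
  simp only [mul_one, hGe, integral_const, probReal_univ, smul_eq_mul] at h1
  obtain ⟨h2, h3⟩ := hC Real.log Real.measurable_log
  obtain ⟨g1, -⟩ := gamma_log ha
  have hpt : Set.EqOn (fun t : ℝ => t ^ ((k:ℝ)/2-1) * (Real.exp (-t) * Real.log (2*t)))
      (fun t => t ^ ((k:ℝ)/2-1) * (Real.exp (-t) * Real.log t) +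
        Real.log 2 * (t ^ ((k:ℝ)/2-1) * Real.exp (-t))) (Set.Ioi 0) := by
    intro t ht
    have ht : 0 < t := ht
    simp only
    rw [Real.log_mul (by norm_num) ht.ne']
    ring
  constructor
  · apply h3
    rw [integrableOn_congr_fun hpt measurableSet_Ioi]
    exact g1.add (hGi.const_mul _)
  · rw [h2, setIntegral_congr_fun measurableSet_Ioi hpt, integral_add g1 (hGi.const_mul _),
      integral_const_mul, hGe, ← log_deriv_digamma ha]
    linear_combination (-(Real.log 2 + digamma ((k:ℝ)/2))) * h1

/-- Columns of the sample matrix as Euclidean vectors. -/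
noncomputable def sampleCol {n d : ℕ} (Y : Fin n → Fin d → ℝ) (a : Fin d) :
    EuclideanSpace ℝ (Fin n) := WithLp.toLp 2 (fun i => Y i a)

lemma wishart_eq_gram (n d : ℕ) (Y : Fin n → Fin d → ℝ) :
    wishart n d Y = gram ℝ (sampleCol Y) := by
  ext a b
  simp [wishart, gram_apply, sampleCol, PiLp.inner_apply, Matrix.sum_apply, vecMulVec_apply,
    mul_comm]

lemma measurable_det_wishart (n d : ℕ) : Measurable (fun Y => (wishart n d Y).det) := by
  simp only [Matrix.det_apply, wishart, Matrix.sum_apply, vecMulVec_apply]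
  fun_prop

/-- Split off the first column. -/
noncomputable def splitCol (n d : ℕ) (Y : Fin n → Fin (d+1) → ℝ) :
    (Fin n → ℝ) × (Fin n → Fin d → ℝ) := (fun i => Y i 0, fun i j => Y i j.succ)

lemma measurePreserving_splitCol (n d : ℕ) :
    MeasurePreserving (splitCol n d) (stdGaussianSample n (d+1))
      ((Measure.pi fun _ => gaussianReal 0 1).prod (stdGaussianSample n d)) := by
  have h1 := measurePreserving_piFinSuccAbove (n := d) (fun _ => gaussianReal 0 1) 0
  have h2 := measurePreserving_pi (fun _ : Fin n => Measure.pi fun _ : Fin (d+1) => gaussianReal 0 1)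
    (fun _ : Fin n => (gaussianReal 0 1).prod (Measure.pi fun _ : Fin d => gaussianReal 0 1))
    (fun _ => h1)
  have h3 := measurePreserving_arrowProdEquivProdArrow ℝ (Fin d → ℝ) (Fin n)
    (fun _ => gaussianReal 0 1) (fun _ => Measure.pi fun _ : Fin d => gaussianReal 0 1)
  exact h3.comp h2

instance stdGaussianSample_prob (n d : ℕ) : IsProbabilityMeasure (stdGaussianSample n d) := by
  unfold stdGaussianSample; infer_instance

/-- Inverse of splitting. -/
noncomputable def joinCol (n d : ℕ) (p : (Fin n → ℝ) × (Fin n → Fin d → ℝ)) :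
    Fin n → Fin (d+1) → ℝ := fun i => Fin.cons (p.1 i) (p.2 i)

lemma measurable_joinCol (n d : ℕ) : Measurable (joinCol n d) := by
  refine measurable_pi_lambda _ fun i => measurable_pi_lambda _ fun j => ?_
  refine Fin.cases ?_ (fun j => ?_) j
  · simp only [joinCol, Fin.cons_zero]; fun_prop
  · simp only [joinCol, Fin.cons_succ]; fun_prop

lemma join_split (n d : ℕ) (Y : Fin n → Fin (d+1) → ℝ) : joinCol n d (splitCol n d Y) = Y := by
  ext i j
  refine Fin.cases ?_ (fun j => ?_) j <;> simp [joinCol, splitCol]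

/-- Ratio of successive determinants. -/
noncomputable def detRatio (n d : ℕ) (p : (Fin n → ℝ) × (Fin n → Fin d → ℝ)) : ℝ :=
  (wishart n (d+1) (joinCol n d p)).det / (wishart n d p.2).det

lemma measurable_detRatio (n d : ℕ) : Measurable (detRatio n d) :=
  ((measurable_det_wishart n (d+1)).comp (measurable_joinCol n d)).div
    ((measurable_det_wishart n d).comp measurable_snd)

lemma det_join (n d : ℕ) (x : Fin n → ℝ) (X : Fin n → Fin d → ℝ) :
    (wishart n (d+1) (joinCol n d (x, X))).det =
      ‖(Submodule.span ℝ (Set.range (sampleCol X)))ᗮ.orthogonalProjectionOnto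
        (WithLp.toLp 2 x)‖ ^ 2 * (wishart n d X).det := by
  rw [wishart_eq_gram, wishart_eq_gram, ← det_gram_cons]
  congr 2
  ext a i
  refine Fin.cases ?_ (fun j => ?_) a <;> simp [joinCol, sampleCol]

lemma law_detRatio_fiber (n d k : ℕ) (hk : d + k = n) (X : Fin n → Fin d → ℝ)
    (hX : (wishart n d X).det ≠ 0) :
    (Measure.pi fun _ : Fin n => gaussianReal 0 1).map (fun x => detRatio n d (x, X)) =
      chiSqLaw k := by
  set S := Submodule.span ℝ (Set.range (sampleCol X)) with hS
  have hli : LinearIndependent ℝ (sampleCol X) := by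
    rw [wishart_eq_gram] at hX
    exact linearIndependent_of_det_gram_ne_zero hX
  have hfr : Module.finrank ℝ S = d := by
    rw [finrank_span_eq_card hli]; simp
  have hfr' : Module.finrank ℝ Sᗮ = k := by
    have := S.finrank_add_finrank_orthogonal
    rw [hfr] at this
    simp at this
    omega
  rw [← map_norm_proj Sᗮ hfr', ← map_pi_eq_stdGaussian, Measure.map_map (by fun_prop) (by fun_prop)]
  congr 1
  ext x
  simp only [detRatio, det_join, Function.comp]
  rw [mul_div_cancel_right₀ _ hX]

lemma law_detRatio (n d k : ℕ) (hk : d + k = n)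
    (h : ∀ᵐ X ∂(stdGaussianSample n d), (wishart n d X).det ≠ 0) :
    MeasurePreserving (detRatio n d)
      ((Measure.pi fun _ => gaussianReal 0 1).prod (stdGaussianSample n d)) (chiSqLaw k) := by
  refine ⟨measurable_detRatio n d, ?_⟩
  ext s hs
  rw [Measure.map_apply (measurable_detRatio n d) hs,
    Measure.prod_apply_symm (measurable_detRatio n d hs)]
  have : ∀ᵐ X ∂(stdGaussianSample n d), (Measure.pi fun _ : Fin n => gaussianReal 0 1)
      ((fun x => (x, X)) ⁻¹' (detRatio n d ⁻¹' s)) = chiSqLaw k s := by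
    filter_upwards [h] with X hX
    rw [← law_detRatio_fiber n d k hk X hX, Measure.map_apply _ hs]
    · rfl
    · exact (measurable_detRatio n d).comp (by fun_prop)
  rw [lintegral_congr_ae this]
  simp

theorem main_aux (n d : ℕ) (hn : d ≤ n) :
    (∀ᵐ Y ∂(stdGaussianSample n d), (wishart n d Y).det ≠ 0) ∧
    Integrable (fun Y => Real.log (wishart n d Y).det) (stdGaussianSample n d) ∧
    ∫ Y, Real.log (wishart n d Y).det ∂(stdGaussianSample n d)
      = d * Real.log 2 + ∑ j ∈ Finset.Icc 1 d, digamma (((n : ℝ) - j + 1) / 2) := by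
  induction d with
  | zero => simp
  | succ d ih =>
    obtain ⟨i1, i2, i3⟩ := ih (by omega)
    obtain ⟨k, hk⟩ : ∃ k, d + k = n := ⟨n - d, by omega⟩
    have hk1 : 1 ≤ k := by omega
    have hsp := measurePreserving_splitCol n d
    have hq := (law_detRatio n d k hk i1).comp hsp
    have hsnd : MeasurePreserving (fun Y => (splitCol n d Y).2) (stdGaussianSample n (d+1))
        (stdGaussianSample n d) := measurePreserving_snd.comp hsp
    have hq0 := hq.quasiMeasurePreserving.ae (chiSq_ne_zero k hk1)
    have hD0 := hsnd.quasiMeasurePreserving.ae i1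
    have hfac : ∀ᵐ Y ∂(stdGaussianSample n (d+1)), (wishart n (d+1) Y).det =
        (detRatio n d ∘ splitCol n d) Y * (wishart n d (splitCol n d Y).2).det := by
      filter_upwards [hD0] with Y hY
      simp only [Function.comp, detRatio, join_split]
      rw [div_mul_cancel₀ _ hY]
    have hlog : (fun Y => Real.log (wishart n (d+1) Y).det) =ᵐ[stdGaussianSample n (d+1)]
        (fun Y => Real.log ((detRatio n d ∘ splitCol n d) Y) +
          Real.log (wishart n d (splitCol n d Y).2).det) := by
      filter_upwards [hfac, hq0, hD0] with Y h1 h2 h3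
      rw [h1, Real.log_mul h2 h3]
    obtain ⟨c1, c2⟩ := chiSq_log k hk1
    have I1 : Integrable (fun Y => Real.log ((detRatio n d ∘ splitCol n d) Y))
        (stdGaussianSample n (d+1)) := hq.integrable_comp_of_integrable c1
    have I2 : Integrable (fun Y => Real.log (wishart n d (splitCol n d Y).2).det)
        (stdGaussianSample n (d+1)) := hsnd.integrable_comp_of_integrable i2
    have E1 : ∫ Y, Real.log ((detRatio n d ∘ splitCol n d) Y) ∂(stdGaussianSample n (d+1)) =
        Real.log 2 + digamma ((k:ℝ)/2) := by
      rw [← c2, ← hq.map_eq, integral_map hq.measurable.aemeasurable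
        Real.measurable_log.aestronglyMeasurable]
    have E2 : ∫ Y, Real.log (wishart n d (splitCol n d Y).2).det ∂(stdGaussianSample n (d+1)) =
        ∫ Y, Real.log (wishart n d Y).det ∂(stdGaussianSample n d) := by
      rw [← hsnd.map_eq]
      exact (integral_map hsnd.measurable.aemeasurable
        (Real.measurable_log.comp (measurable_det_wishart n d)).aestronglyMeasurable).symm
    refine ⟨?_, (I1.add I2).congr hlog.symm, ?_⟩
    · filter_upwards [hfac, hq0, hD0] with Y h1 h2 h3
      rw [h1]
      exact mul_ne_zero h2 h3
    · rw [integral_congr_ae hlog, integral_add I1 I2, E1, E2, i3,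
        Finset.sum_Icc_succ_top (by omega)]
      have : ((n:ℝ) - ((d+1 : ℕ) : ℝ) + 1) / 2 = (k:ℝ) / 2 := by
        rw [← hk]; push_cast; ring
      rw [this]
      push_cast
      ring

theorem expected_log_det_wishart (d n : ℕ) (hd : 1 ≤ d) (hn : d ≤ n) :
    ∫ Y, Real.log (wishart n d Y).det ∂(stdGaussianSample n d)
      = d * Real.log 2 + ∑ j ∈ Finset.Icc 1 d, digamma (((n : ℝ) - j + 1) / 2) :=
  (main_aux n d hn).2.2
end

section
/- Let d ≥ 1 and n ≥ d be integers. Let Y_1, …, Y_n be i.i.d. standard Gaussian random vectors in ℝ^d and let W := ∑_{i=1}^n Y_i Y_iᵀ. If n > d+1, then the entrywise expectation of the inverse satisfies E[W⁻¹] = (1/(n−d−1))·I_d, and in particular E[tr(W⁻¹)] = d/(n−d−1). If n ≤ d+1, then the (lower Lebesgue) expectation of (W⁻¹)_{11} is +∞. -/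
open MeasureTheory ProbabilityTheory Matrix

lemma aux_single (t : ℝ) (ht : 0 < t) :
    ∫ z, Real.exp (-t * z ^ 2) ∂(gaussianReal 0 1) = (1 + 2 * t) ^ (-(1 / 2) : ℝ) := by
  rw [integral_gaussianReal_eq_integral_smul one_ne_zero]
  have h : ∀ z : ℝ, gaussianPDFReal 0 1 z • Real.exp (-t * z ^ 2)
      = (√(2 * Real.pi))⁻¹ * Real.exp (-(t + 1 / 2) * z ^ 2) := by
    intro z
    simp only [gaussianPDFReal, smul_eq_mul, NNReal.coe_one, mul_one, sub_zero]
    rw [mul_assoc, ← Real.exp_add]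
    congr 2
    ring
  simp_rw [h]
  rw [integral_const_mul, integral_gaussian, Real.rpow_neg (by positivity), ← Real.sqrt_eq_rpow,
    ← Real.sqrt_inv, ← Real.sqrt_inv, ← Real.sqrt_mul (by positivity)]
  congr 1
  have := Real.pi_pos
  field_simp
  ring

lemma aux_prod (m : ℕ) (t : ℝ) (ht : 0 < t) :
    ∫⁻ z : Fin m → ℝ, ENNReal.ofReal (Real.exp (-t * ∑ i, z i ^ 2))
      ∂(Measure.pi fun _ => gaussianReal 0 1) = ENNReal.ofReal ((1 + 2 * t) ^ (-(m / 2 : ℝ))) := by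
  rw [← ofReal_integral_eq_lintegral_ofReal]
  · have h : ∀ z : Fin m → ℝ, Real.exp (-t * ∑ i, z i ^ 2) = ∏ i, Real.exp (-t * z i ^ 2) := by
      intro z; rw [← Real.exp_sum, Finset.mul_sum]
    simp_rw [h]
    rw [integral_fintype_prod_eq_pow (μ := gaussianReal 0 1) (fun x : ℝ => Real.exp (-t * x ^ 2)), aux_single t ht, ← Real.rpow_natCast,
      ← Real.rpow_mul (by positivity)]
    congr 2
    simp
    ring
  · refine Integrable.of_bound (Measurable.aestronglyMeasurable (by fun_prop)) 1 (ae_of_all _ fun z => ?_)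
    rw [Real.norm_eq_abs, abs_of_pos (Real.exp_pos _)]
    apply Real.exp_le_one_iff.2
    have : 0 ≤ ∑ i, z i ^ 2 := by positivity
    nlinarith
  · exact ae_of_all _ fun z => by positivity

lemma aux_inv (s : ℝ) (hs : 0 < s) :
    ∫⁻ t in Set.Ioi (0 : ℝ), ENNReal.ofReal (Real.exp (-t * s)) = ENNReal.ofReal (1 / s) := by
  have e : ∀ t : ℝ, -t * s = (-s) * t := by intro t; ring
  simp_rw [e]
  rw [← ofReal_integral_eq_lintegral_ofReal]
  · rw [integral_exp_mul_Ioi (by linarith)]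
    simp
  · exact integrableOn_exp_mul_Ioi (by linarith) 0
  · exact ae_of_all _ fun z => by positivity

lemma aux_fin (m : ℕ) (hm : 2 < m) :
    ∫⁻ t in Set.Ioi (0 : ℝ), ENNReal.ofReal ((1 + 2 * t) ^ (-(m / 2 : ℝ)))
      = ENNReal.ofReal (1 / ((m : ℝ) - 2)) := by
  have hm' : (2 : ℝ) < m := by exact_mod_cast hm
  have hd : ∀ x ∈ Set.Ici (0 : ℝ), HasDerivAt (fun t : ℝ => -(1 / ((m : ℝ) - 2)) * (1 + 2 * t) ^ (1 - (m / 2 : ℝ)))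
      ((1 + 2 * x) ^ (-(m / 2 : ℝ))) x := by
    intro x hx
    have hx : 0 ≤ x := hx
    have h1 : HasDerivAt (fun t : ℝ => 1 + 2 * t) 2 x := by
      simpa using ((hasDerivAt_id x).const_mul 2).const_add 1
    have h2 := (h1.rpow_const (p := 1 - (m / 2 : ℝ)) (Or.inl (by positivity))).const_mul (-(1 / ((m : ℝ) - 2)))
    refine h2.congr_deriv ?_
    rw [show (1 - (m / 2 : ℝ) - 1) = -(m / 2 : ℝ) by ring]
    have : (m : ℝ) - 2 ≠ 0 := by linarith
    field_simp
    ring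
  have hlim : Filter.Tendsto (fun t : ℝ => -(1 / ((m : ℝ) - 2)) * (1 + 2 * t) ^ (1 - (m / 2 : ℝ))) Filter.atTop (nhds 0) := by
    have h0 : Filter.Tendsto (fun t : ℝ => 1 + 2 * t) Filter.atTop Filter.atTop :=
      Filter.tendsto_atTop_add_const_left _ _ (Filter.tendsto_id.const_mul_atTop (by norm_num))
    have h1 := (tendsto_rpow_neg_atTop (y := (m / 2 : ℝ) - 1) (by linarith)).comp h0
    simpa using h1.const_mul (-(1 / ((m : ℝ) - 2)))
  have hnn : ∀ x ∈ Set.Ioi (0 : ℝ), 0 ≤ (1 + 2 * x) ^ (-(m / 2 : ℝ)) := by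
    intro x hx
    have hx : 0 < x := hx
    positivity
  rw [← ofReal_integral_eq_lintegral_ofReal]
  · rw [integral_Ioi_of_hasDerivAt_of_nonneg' hd hnn hlim]
    simp
  · exact integrableOn_Ioi_deriv_of_nonneg' hd hnn hlim
  · exact (ae_restrict_iff' measurableSet_Ioi).2 (ae_of_all _ hnn)

lemma aux_top (m : ℕ) (hm : m ≤ 2) :
    ∫⁻ t in Set.Ioi (0 : ℝ), ENNReal.ofReal ((1 + 2 * t) ^ (-(m / 2 : ℝ))) = ⊤ := by
  by_contra hne
  have hm' : (m : ℝ) ≤ 2 := by exact_mod_cast hm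
  have hm0 : Measurable (fun t : ℝ => (1 + 2 * t) ^ (-(m / 2 : ℝ))) := by fun_prop
  have hi : IntegrableOn (fun t : ℝ => (1 + 2 * t) ^ (-(m / 2 : ℝ))) (Set.Ioi 0) := by
    refine (lintegral_ofReal_ne_top_iff_integrable hm0.aestronglyMeasurable ?_).1 hne
    refine (ae_restrict_iff' measurableSet_Ioi).2 (ae_of_all _ fun x hx => ?_)
    have hx : 0 < x := hx
    simp only [Pi.zero_apply]
    positivity
  have hi1 : IntegrableOn (fun t : ℝ => 3 * (1 + 2 * t) ^ (-(m / 2 : ℝ))) (Set.Ioi 1) :=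
    (hi.mono_set (Set.Ioi_subset_Ioi zero_le_one)).const_mul 3
  have : IntegrableOn (fun t : ℝ => t ^ (-1 : ℝ)) (Set.Ioi 1) := by
    refine hi1.mono' (by fun_prop) ((ae_restrict_iff' measurableSet_Ioi).2 (ae_of_all _ fun x hx => ?_))
    have hx : 1 < x := hx
    rw [Real.norm_eq_abs, abs_of_nonneg (by positivity)]
    have h1 : (1 + 2 * x) ^ (-1 : ℝ) ≤ (1 + 2 * x) ^ (-(m / 2 : ℝ)) :=
      Real.rpow_le_rpow_of_exponent_le (by linarith) (by linarith)
    have h2 : x ^ (-1 : ℝ) ≤ 3 * (1 + 2 * x) ^ (-1 : ℝ) := by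
      rw [Real.rpow_neg_one, Real.rpow_neg_one]
      field_simp
      linarith
    linarith
  rw [integrableOn_Ioi_rpow_iff zero_lt_one] at this
  linarith

lemma aux_ne_zero (m : ℕ) (hm : 1 ≤ m) :
    ∀ᵐ z : Fin m → ℝ ∂(Measure.pi fun _ => gaussianReal 0 1), 0 < ∑ i, z i ^ 2 := by
  have := nullSingletonClass_gaussianReal (μ := 0) (v := 1) one_ne_zero
  have h : ∀ᵐ x ∂(gaussianReal 0 1), x ≠ 0 := by
    simp [ae_iff]
  have h2 := (measurePreserving_eval (fun _ : Fin m => gaussianReal 0 1) ⟨0, hm⟩).quasiMeasurePreserving.ae h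
  filter_upwards [h2] with z hz
  have : 0 < z ⟨0, hm⟩ ^ 2 := by
    have : z ⟨0, hm⟩ ≠ 0 := hz
    positivity
  refine this.trans_le (Finset.single_le_sum (f := fun i => z i ^ 2) (fun i _ => by positivity) (Finset.mem_univ _))

lemma aux_pi (m : ℕ) (hm : 1 ≤ m) :
    ∫⁻ z : Fin m → ℝ, ENNReal.ofReal (1 / ∑ i, z i ^ 2)
      ∂(Measure.pi fun _ => gaussianReal 0 1)
    = ∫⁻ t in Set.Ioi (0 : ℝ), ENNReal.ofReal ((1 + 2 * t) ^ (-(m / 2 : ℝ))) := by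
  have h1 : ∫⁻ z : Fin m → ℝ, ENNReal.ofReal (1 / ∑ i, z i ^ 2)
      ∂(Measure.pi fun _ => gaussianReal 0 1) = ∫⁻ z : Fin m → ℝ, (∫⁻ t in Set.Ioi (0 : ℝ),
        ENNReal.ofReal (Real.exp (-t * ∑ i, z i ^ 2))) ∂(Measure.pi fun _ => gaussianReal 0 1) := by
    refine lintegral_congr_ae ?_
    filter_upwards [aux_ne_zero m hm] with z hz
    rw [aux_inv _ hz]
  rw [h1, lintegral_lintegral_swap (by fun_prop)]
  exact setLIntegral_congr_fun measurableSet_Ioi fun t ht => aux_prod m t ht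

/-- Expected inverse squared norm under a standard Gaussian. -/
noncomputable def auxVal (m : ℕ) : ENNReal :=
  ∫⁻ t in Set.Ioi (0 : ℝ), ENNReal.ofReal ((1 + 2 * t) ^ (-(m / 2 : ℝ)))

lemma aux_norm_sq {E : Type*} [NormedAddCommGroup E] [InnerProductSpace ℝ E] {m : ℕ} (b : OrthonormalBasis (Fin m) ℝ E) (x : Fin m → ℝ) :
    ‖∑ i, x i • b i‖ ^ 2 = ∑ i, x i ^ 2 := by
  rw [← b.sum_sq_norm_inner_right]
  refine Finset.sum_congr rfl fun i _ => ?_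
  rw [b.orthonormal.inner_right_fintype]
  simp

lemma aux_std  {E : Type*} [NormedAddCommGroup E] [InnerProductSpace ℝ E]
    [FiniteDimensional ℝ E] [MeasurableSpace E] [BorelSpace E]
    (hE : 1 ≤ Module.finrank ℝ E) :
    ∫⁻ x, ENNReal.ofReal (1 / ‖x‖ ^ 2) ∂(stdGaussian E) = auxVal (Module.finrank ℝ E) := by
  rw [stdGaussian, lintegral_map (by fun_prop) (by fun_prop)]
  simp_rw [aux_norm_sq]
  exact aux_pi _ hE

lemma aux_std_ne  {E : Type*} [NormedAddCommGroup E] [InnerProductSpace ℝ E]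
    [FiniteDimensional ℝ E] [MeasurableSpace E] [BorelSpace E]
    (hE : 1 ≤ Module.finrank ℝ E) :
    ∀ᵐ x ∂(stdGaussian E), x ≠ 0 := by
  rw [stdGaussian, ae_map_iff (Measurable.aemeasurable (by fun_prop)) (by measurability)]
  filter_upwards [aux_ne_zero _ hE] with z hz h
  rw [← aux_norm_sq (stdOrthonormalBasis ℝ E), h] at hz
  simp at hz

lemma aux_proj  {E : Type*} [NormedAddCommGroup E] [InnerProductSpace ℝ E]
    [FiniteDimensional ℝ E] [MeasurableSpace E] [BorelSpace E]
    (S : Submodule ℝ E) :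
    (stdGaussian E).map (S.orthogonalProjectionOnto) = stdGaussian S := by
  apply Measure.ext_of_charFun
  ext t
  rw [charFun_stdGaussian, charFun_apply, integral_map (by fun_prop) (by fun_prop)]
  have : ∀ x : E, inner ℝ (S.orthogonalProjectionOnto x) t = inner ℝ x (t : E) := by
    intro x
    simp
  simp_rw [this]
  rw [← charFun_apply, charFun_stdGaussian]
  simp

/-- The columns of the sample, as Euclidean vectors. -/
noncomputable def auxCols (n d : ℕ) (Y : Fin n → Fin d → ℝ) :
    Fin d → EuclideanSpace ℝ (Fin n) := fun j => WithLp.toLp 2 fun i => Y i j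

lemma aux_swap (n d : ℕ) : MeasurePreserving
    (fun (Y : Fin n → Fin d → ℝ) (j : Fin d) (i : Fin n) => Y i j)
    (stdGaussianSample n d) (stdGaussianSample d n) := by
  have hA : ∀ a b : ℕ, stdGaussianSample a b
      = Measure.infinitePi fun _ : Fin a => Measure.infinitePi fun _ : Fin b => gaussianReal 0 1 := by
    intro a b
    rw [Measure.infinitePi_eq_pi]
    simp_rw [Measure.infinitePi_eq_pi]
    rfl
  refine ⟨by fun_prop, ?_⟩
  rw [hA, hA, ← Measure.infinitePi_map_curry (ι := Fin n) (κ := Fin d) (fun _ _ => gaussianReal 0 1),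
    ← Measure.infinitePi_map_curry (ι := Fin d) (κ := Fin n) (fun _ _ => gaussianReal 0 1),
    ← Measure.infinitePi_map_piCongrLeft (fun _ : Fin d × Fin n => gaussianReal 0 1)
      (Equiv.prodComm (Fin n) (Fin d)), Measure.map_map (by fun_prop) (by fun_prop),
    Measure.map_map (by fun_prop) (by fun_prop)]
  congr 1

lemma aux_cols (n d : ℕ) : MeasurePreserving (auxCols n d) (stdGaussianSample n d)
    (Measure.pi fun _ => stdGaussian (EuclideanSpace ℝ (Fin n))) := by
  have h : MeasurePreserving (fun (X : Fin d → Fin n → ℝ) (j : Fin d) =>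
      (WithLp.toLp 2 (X j) : EuclideanSpace ℝ (Fin n))) (stdGaussianSample d n)
      (Measure.pi fun _ => stdGaussian (EuclideanSpace ℝ (Fin n))) := by
    refine measurePreserving_pi _ _ fun j => ⟨by fun_prop, map_pi_eq_stdGaussian⟩
  exact h.comp (aux_swap n d)

lemma aux_gram (n d : ℕ) (Y : Fin n → Fin d → ℝ) :
    wishart n d Y = gram ℝ (auxCols n d Y) := by
  ext a b
  simp [wishart, auxCols, gram_apply, Matrix.sum_apply, vecMulVec_apply, PiLp.inner_apply, mul_comm]

lemma aux_meas {F : Type*} [NormedAddCommGroup F] [InnerProductSpace ℝ F]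
    [FiniteDimensional ℝ F] [MeasurableSpace F] [BorelSpace F] (d : ℕ) (i j : Fin d) :
    Measurable fun X : Fin d → F => (gram ℝ X)⁻¹ i j := by
  have hc : Continuous fun X : Fin d → F => gram ℝ X := by
    refine continuous_matrix fun a b => ?_
    simp only [gram_apply]
    fun_prop
  simp only [Matrix.inv_def, Ring.inverse_eq_inv', Matrix.smul_apply, smul_eq_mul]
  exact (hc.matrix_det.measurable.inv).mul (hc.matrix_adjugate.matrix_elem i j).measurable

lemma aux_linind {F : Type*} [NormedAddCommGroup F] [InnerProductSpace ℝ F]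
    [FiniteDimensional ℝ F] {k : ℕ} (i : Fin (k + 1)) (Z : Fin k → F) (hZ : LinearIndependent ℝ Z)
    (x : F) (hx : x ∉ Submodule.span ℝ (Set.range Z)) :
    LinearIndependent ℝ (i.insertNth x Z : Fin (k + 1) → F) := by
  rw [Fintype.linearIndependent_iff] at hZ ⊢
  intro c hc
  rw [Fin.sum_univ_succAbove _ i] at hc
  simp only [Fin.insertNth_apply_same, Fin.insertNth_apply_succAbove] at hc
  have h0 : c i = 0 := by
    by_contra hne
    apply hx
    have : x = (-(c i)⁻¹) • ∑ j, c (i.succAbove j) • Z j := by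
      rw [eq_neg_of_add_eq_zero_right hc, smul_neg, neg_smul, neg_neg, smul_smul,
        inv_mul_cancel₀ hne, one_smul]
    rw [this]
    exact Submodule.smul_mem _ _ (Submodule.sum_mem _ fun j _ =>
      Submodule.smul_mem _ _ (Submodule.subset_span ⟨j, rfl⟩))
  rw [h0, zero_smul, zero_add] at hc
  intro j
  rcases Fin.eq_self_or_eq_succAbove i j with rfl | ⟨l, rfl⟩
  · exact h0
  · exact hZ (fun j => c (i.succAbove j)) hc l

lemma aux_entry {F : Type*} [NormedAddCommGroup F] [InnerProductSpace ℝ F]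
    [FiniteDimensional ℝ F] {k : ℕ} (i : Fin (k + 1)) (Z : Fin k → F) (hZ : LinearIndependent ℝ Z)
    (x : F) (hx : (Submodule.span ℝ (Set.range Z))ᗮ.orthogonalProjectionOnto x ≠ 0) :
    (gram ℝ (i.insertNth x Z : Fin (k + 1) → F))⁻¹ i i
      = 1 / ‖(Submodule.span ℝ (Set.range Z))ᗮ.orthogonalProjectionOnto x‖ ^ 2 := by
  set S := Submodule.span ℝ (Set.range Z) with hS
  set p := Sᗮ.orthogonalProjectionOnto x with hp
  have hxS : x ∉ S := by
    intro h
    apply hx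
    rw [hp, Submodule.orthogonalProjectionOnto_eq_zero_iff]
    exact Submodule.le_orthogonal_orthogonal S h
  have hdet := (det_gram_ne_zero_iff_linearIndependent (𝕜 := ℝ)).2 (aux_linind i Z hZ x hxS)
  have hpS : x - (p : F) ∈ S := by
    have := Submodule.sub_starProjection_mem_orthogonal (K := Sᗮ) x
    rw [Submodule.orthogonal_orthogonal] at this
    exact this
  obtain ⟨c, hc⟩ := (Submodule.mem_span_range_iff_exists_fun ℝ).1 hpS
  have hpp : inner ℝ x (p : F) = ‖p‖ ^ 2 := by
    have h1 : inner ℝ (x - (p : F)) (p : F) = 0 := p.2 _ hpS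
    rw [inner_sub_left, real_inner_self_eq_norm_sq] at h1
    have : ‖(p : F)‖ = ‖p‖ := rfl
    rw [← this]; linarith
  have hZp : ∀ j, inner ℝ (Z j) (p : F) = 0 := fun j =>
    p.2 _ (Submodule.subset_span ⟨j, rfl⟩)
  have hn : ‖p‖ ^ 2 ≠ 0 := by simpa using hx
  let X : Fin (k + 1) → F := i.insertNth x Z
  let v : Fin (k + 1) → ℝ := i.insertNth (1 / ‖p‖ ^ 2) (fun j => - (1 / ‖p‖ ^ 2) * c j)
  have hv : ∑ b, v b • X b = (1 / ‖p‖ ^ 2) • (p : F) := by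
    rw [Fin.sum_univ_succAbove _ i]
    simp only [v, X, Fin.insertNth_apply_same, Fin.insertNth_apply_succAbove]
    simp_rw [mul_smul]
    rw [← Finset.smul_sum, hc, neg_smul, smul_sub]
    abel
  have hW : gram ℝ X *ᵥ v = Pi.single i 1 := by
    ext a
    have h1 : (gram ℝ X *ᵥ v) a = inner ℝ (X a) (∑ b, v b • X b) := by
      simp only [mulVec, dotProduct, gram_apply, inner_sum, inner_smul_right]
      exact Finset.sum_congr rfl fun b _ => mul_comm _ _
    rw [h1, hv, inner_smul_right]
    rcases Fin.eq_self_or_eq_succAbove i a with rfl | ⟨l, rfl⟩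
    · simp only [X, Fin.insertNth_apply_same, hpp, Pi.single_eq_same]
      field_simp
    · simp [X, hZp]
  have h2 : v = (gram ℝ X)⁻¹ *ᵥ Pi.single i 1 := by
    rw [← hW, mulVec_mulVec, nonsing_inv_mul _ (isUnit_iff_ne_zero.2 hdet), one_mulVec]
  have h3 := congrFun h2 i
  simp only [mulVec_single_one, col_apply] at h3
  rw [← h3]
  simp [v]

lemma aux_finrank {n k : ℕ} (Z : Fin k → EuclideanSpace ℝ (Fin n)) (hZ : LinearIndependent ℝ Z) :
    Module.finrank ℝ (Submodule.span ℝ (Set.range Z))ᗮ = n - k := by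
  have h1 := finrank_span_eq_card hZ
  have h2 := Submodule.finrank_add_finrank_orthogonal (Submodule.span ℝ (Set.range Z))
  simp at h1 h2
  omega

lemma aux_proj_ne {n k : ℕ} (hk : k < n) (Z : Fin k → EuclideanSpace ℝ (Fin n))
    (hZ : LinearIndependent ℝ Z) : ∀ᵐ x ∂(stdGaussian (EuclideanSpace ℝ (Fin n))),
      (Submodule.span ℝ (Set.range Z))ᗮ.orthogonalProjectionOnto x ≠ 0 := by
  have h := aux_std_ne (E := (Submodule.span ℝ (Set.range Z))ᗮ) (by rw [aux_finrank Z hZ]; omega)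
  rw [← aux_proj] at h
  exact ae_of_ae_map (f := (Submodule.span ℝ (Set.range Z))ᗮ.orthogonalProjectionOnto)
    (p := fun y => y ≠ 0) (by fun_prop) h

lemma aux_measset {n k : ℕ} :
    MeasurableSet {X : Fin k → EuclideanSpace ℝ (Fin n) | LinearIndependent ℝ X} := by
  have : {X : Fin k → EuclideanSpace ℝ (Fin n) | LinearIndependent ℝ X}
      = {X | (gram ℝ X).det ≠ 0} := by
    ext X
    exact (det_gram_ne_zero_iff_linearIndependent (𝕜 := ℝ)).symm
  rw [this]
  have hc : Continuous fun X : Fin k → EuclideanSpace ℝ (Fin n) => gram ℝ X := by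
    refine continuous_matrix fun a b => ?_
    simp only [gram_apply]
    fun_prop
  exact (hc.matrix_det.measurable (measurableSet_singleton 0)).compl

lemma aux_ae_linind {n : ℕ} : ∀ k : ℕ, k ≤ n →
    ∀ᵐ X ∂(Measure.pi fun _ : Fin k => stdGaussian (EuclideanSpace ℝ (Fin n))),
      LinearIndependent ℝ X := by
  intro k
  induction k with
  | zero => intro _; exact ae_of_all _ fun X => linearIndependent_empty_type
  | succ k ih =>
    intro hk
    have hmp := ((measurePreserving_piFinSuccAbove
      (fun _ : Fin (k + 1) => stdGaussian (EuclideanSpace ℝ (Fin n))) 0).symm).comp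
      Measure.measurePreserving_swap
    rw [← hmp.map_eq, ae_map_iff hmp.measurable.aemeasurable aux_measset]
    refine (Measure.ae_prod_iff_ae_ae (hmp.measurable aux_measset)).2 ?_
    filter_upwards [ih (by omega)] with Z hZ
    filter_upwards [aux_proj_ne (by omega) Z hZ] with x hx
    refine aux_linind 0 Z hZ x fun h => hx ?_
    rw [Submodule.orthogonalProjectionOnto_eq_zero_iff]
    exact Submodule.le_orthogonal_orthogonal _ h

lemma aux_main {n k : ℕ} (hk : k < n) (i : Fin (k + 1)) :
    ∫⁻ X, ENNReal.ofReal ((gram ℝ X)⁻¹ i i)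
      ∂(Measure.pi fun _ : Fin (k + 1) => stdGaussian (EuclideanSpace ℝ (Fin n)))
    = auxVal (n - k) := by
  have hmp := (measurePreserving_piFinSuccAbove
      (fun _ : Fin (k + 1) => stdGaussian (EuclideanSpace ℝ (Fin n))) i).symm
  have hm := (aux_meas (F := EuclideanSpace ℝ (Fin n)) (k + 1) i i).ennreal_ofReal
  rw [← hmp.lintegral_comp hm]
  refine (lintegral_prod_symm' _ (hm.comp hmp.measurable)).trans ?_
  have : ∀ᵐ Z ∂(Measure.pi fun _ : Fin k => stdGaussian (EuclideanSpace ℝ (Fin n))),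
      ∫⁻ x, ENNReal.ofReal ((gram ℝ (i.insertNth x Z : Fin (k + 1) → _))⁻¹ i i)
        ∂(stdGaussian (EuclideanSpace ℝ (Fin n))) = auxVal (n - k) := by
    filter_upwards [aux_ae_linind k hk.le] with Z hZ
    have h1 := lintegral_congr_ae (μ := stdGaussian (EuclideanSpace ℝ (Fin n)))
      (f := fun x => ENNReal.ofReal ((gram ℝ (i.insertNth x Z : Fin (k + 1) → _))⁻¹ i i))
      (g := fun x => ENNReal.ofReal
        (1 / ‖(Submodule.span ℝ (Set.range Z))ᗮ.orthogonalProjectionOnto x‖ ^ 2)) (by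
        filter_upwards [aux_proj_ne hk Z hZ] with x hx
        rw [aux_entry i Z hZ x hx])
    rw [h1]
    have h2 := aux_std (E := (Submodule.span ℝ (Set.range Z))ᗮ) (by rw [aux_finrank Z hZ]; omega)
    rw [← aux_proj, lintegral_map (by fun_prop) (by fun_prop), aux_finrank Z hZ] at h2
    exact h2
  refine (lintegral_congr_ae this).trans ?_
  simp

lemma aux_diag {n d : ℕ} (hn : d ≤ n) (i : Fin d) :
    ∫⁻ Y, ENNReal.ofReal ((wishart n d Y)⁻¹ i i) ∂(stdGaussianSample n d) = auxVal (n + 1 - d) := by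
  obtain ⟨k, rfl⟩ : ∃ k, d = k + 1 := ⟨d - 1, by have := i.pos; omega⟩
  simp_rw [aux_gram]
  rw [(aux_cols n (k + 1)).lintegral_comp (aux_meas (k + 1) i i).ennreal_ofReal,
    aux_main (by omega) i]
  congr 1
  omega

lemma aux_meas_wishart (n d : ℕ) (i j : Fin d) :
    Measurable fun Y : Fin n → Fin d → ℝ => (wishart n d Y)⁻¹ i j := by
  simp_rw [aux_gram]
  exact (aux_meas d i j).comp (aux_cols n d).measurable

lemma aux_nonneg (n d : ℕ) (i : Fin d) (Y : Fin n → Fin d → ℝ) : 0 ≤ (wishart n d Y)⁻¹ i i := by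
  rw [aux_gram]
  exact (posSemidef_gram ℝ _).inv.diag_nonneg

lemma aux_offdiag (n d : ℕ) (i j : Fin d) (hij : i ≠ j) :
    ∫ Y, (wishart n d Y)⁻¹ i j ∂(stdGaussianSample n d) = 0 := by
  let s : Fin d → ℝ := fun a => if a = i then -1 else 1
  have hs : ∀ a, s a * s a = 1 := by intro a; by_cases h : a = i <;> simp [s, h]
  have hmp : MeasurePreserving (fun (Y : Fin n → Fin d → ℝ) a b => s b * Y a b)
      (stdGaussianSample n d) (stdGaussianSample n d) := by
    refine measurePreserving_pi _ _ fun a => measurePreserving_pi _ _ fun b => ⟨by fun_prop, ?_⟩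
    rw [gaussianReal_map_const_mul]
    congr 1
    · simp
    · ext; simp [pow_two, hs]
  have hW : ∀ Y : Fin n → Fin d → ℝ, wishart n d (fun a b => s b * Y a b)
      = diagonal s * wishart n d Y * diagonal s := by
    intro Y
    ext a b
    simp only [wishart, mul_diagonal, diagonal_mul, Matrix.sum_apply, vecMulVec_apply, Finset.mul_sum,
      Finset.sum_mul]
    exact Finset.sum_congr rfl fun _ _ => by ring
  have hD : (diagonal s)⁻¹ = diagonal s := by
    apply inv_eq_left_inv
    rw [diagonal_mul_diagonal]
    simp [hs]
  have hI : ∀ Y : Fin n → Fin d → ℝ, (wishart n d (fun a b => s b * Y a b))⁻¹ i j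
      = - (wishart n d Y)⁻¹ i j := by
    intro Y
    rw [hW, Matrix.mul_inv_rev, Matrix.mul_inv_rev, hD, ← mul_assoc, mul_diagonal, diagonal_mul]
    simp [s, hij.symm]
  have h := integral_map (μ := stdGaussianSample n d) (f := fun Y => (wishart n d Y)⁻¹ i j) hmp.measurable.aemeasurable
    (aux_meas_wishart n d i j).aestronglyMeasurable
  rw [hmp.map_eq] at h
  rw [integral_congr_ae (ae_of_all _ hI), integral_neg] at h
  linarith

theorem expected_inv_wishart (d n : ℕ) (hd : 1 ≤ d) (hn : d ≤ n) :
    (d + 1 < n →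
      (∀ i j : Fin d,
        ∫ Y, ((wishart n d Y)⁻¹) i j ∂(stdGaussianSample n d)
          = (1 / ((n : ℝ) - d - 1)) * (1 : Matrix (Fin d) (Fin d) ℝ) i j) ∧
      ∫ Y, ((wishart n d Y)⁻¹).trace ∂(stdGaussianSample n d)
        = d / ((n : ℝ) - d - 1)) ∧
    (n ≤ d + 1 →
      ∫⁻ Y, ENNReal.ofReal (((wishart n d Y)⁻¹) ⟨0, hd⟩ ⟨0, hd⟩)
          ∂(stdGaussianSample n d) = ⊤) := by
  refine ⟨fun h => ?_, fun h => ?_⟩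
  · have hv : auxVal (n + 1 - d) = ENNReal.ofReal (1 / ((n : ℝ) - d - 1)) := by
      rw [auxVal, aux_fin _ (by omega), Nat.cast_sub (by omega)]
      congr 2
      push_cast
      ring
    have hpos : 0 ≤ 1 / ((n : ℝ) - d - 1) := by
      have : (d : ℝ) + 1 < n := by exact_mod_cast h
      apply one_div_nonneg.2
      linarith
    have hdiag : ∀ i : Fin d, ∫ Y, ((wishart n d Y)⁻¹) i i ∂(stdGaussianSample n d)
        = 1 / ((n : ℝ) - d - 1) := by
      intro i
      rw [integral_eq_lintegral_of_nonneg_ae (ae_of_all _ (aux_nonneg n d i))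
        (aux_meas_wishart n d i i).aestronglyMeasurable, aux_diag hn i, hv, ENNReal.toReal_ofReal hpos]
    have hint : ∀ i : Fin d, Integrable (fun Y => ((wishart n d Y)⁻¹) i i) (stdGaussianSample n d) := by
      intro i
      refine (lintegral_ofReal_ne_top_iff_integrable
        (aux_meas_wishart n d i i).aestronglyMeasurable (ae_of_all _ (aux_nonneg n d i))).1 ?_
      rw [aux_diag hn i, hv]
      exact ENNReal.ofReal_ne_top
    refine ⟨fun i j => ?_, ?_⟩
    · by_cases hij : i = j
      · subst hij
        rw [hdiag]
        simp
      · rw [aux_offdiag n d i j hij]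
        simp [hij]
    · simp only [Matrix.trace, Matrix.diag_apply]
      rw [integral_finsetSum _ fun i _ => hint i]
      simp_rw [hdiag]
      simp [div_eq_mul_inv]
  · rw [aux_diag hn, auxVal, aux_top _ (by omega)]
end

section
/- Let d ≥ 1 and n ≥ 2 be integers. Let Y_1, …, Y_n be i.i.d. standard Gaussian random vectors in ℝ^d, let Ȳ := (1/n) ∑_{i=1}^n Y_i and W_c := ∑_{i=1}^n (Y_i − Ȳ)(Y_i − Ȳ)ᵀ. Then: (i) the law of W_c equals the law of ∑_{i=1}^{n−1} Z_i Z_iᵀ where Z_1, …, Z_{n−1} are i.i.d. standard Gaussian random vectors in ℝ^d (i.e. W_c ~ Wishart_d(n−1, I_d)); and (ii) W_c is independent of Ȳ. -/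
open MeasureTheory ProbabilityTheory Matrix

/-- Matrices carry the product measurable structure. -/
instance (d : ℕ) : MeasurableSpace (Matrix (Fin d) (Fin d) ℝ) :=
  MeasurableSpace.pi

/-- Sample mean `Ȳ = (1/n) ∑ Y_i`. -/
noncomputable def sampleMean (n d : ℕ) (Y : Fin n → Fin d → ℝ) : Fin d → ℝ :=
  ((n : ℝ)⁻¹) • ∑ i : Fin n, Y i

/-- Centered scatter matrix `W_c = ∑ (Y_i - Ȳ)(Y_i - Ȳ)ᵀ`. -/
noncomputable def centeredScatter (n d : ℕ) (Y : Fin n → Fin d → ℝ) :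
    Matrix (Fin d) (Fin d) ℝ :=
  ∑ i : Fin n, vecMulVec (Y i - sampleMean n d Y) (Y i - sampleMean n d Y)

lemma pi_curry_aux (n d : ℕ) : MeasurePreserving
    (fun (f : Fin n × Fin d → ℝ) (i : Fin n) (k : Fin d) => f (i, k))
    (Measure.pi fun _ => gaussianReal 0 1) (stdGaussianSample n d) := by
  refine ⟨by fun_prop, ?_⟩
  have h := Measure.infinitePi_map_curry (fun (_ : Fin n) (_ : Fin d) => gaussianReal 0 1)
  simp only [Measure.infinitePi_eq_pi] at h
  exact h

lemma swap_aux (n d : ℕ) : MeasurePreserving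
    (fun (f : Fin n → Fin d → ℝ) (k : Fin d) (i : Fin n) => f i k)
    (stdGaussianSample n d) (stdGaussianSample d n) := by
  refine ⟨by fun_prop, ?_⟩
  rw [← (pi_curry_aux n d).map_eq, Measure.map_map (by fun_prop) (by fun_prop)]
  rw [← (pi_curry_aux d n).map_eq]
  have h := measurePreserving_piCongrLeft (α := fun _ : Fin d × Fin n => ℝ)
    (fun _ => gaussianReal 0 1) (Equiv.prodComm (Fin n) (Fin d))
  rw [← h.map_eq, Measure.map_map (by fun_prop) (by fun_prop)]
  congr 1

/-- The orthogonal transformation of a sample by the basis `b`. -/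
noncomputable def rotSample {n : ℕ} (d : ℕ)
    (b : OrthonormalBasis (Fin n) ℝ (EuclideanSpace ℝ (Fin n)))
    (Y : Fin n → Fin d → ℝ) : Fin n → Fin d → ℝ := fun i k => ∑ j, b i j * Y j k

lemma rot_one {n : ℕ} (b : OrthonormalBasis (Fin n) ℝ (EuclideanSpace ℝ (Fin n))) :
    MeasurePreserving (fun (y : Fin n → ℝ) (i : Fin n) => ∑ j, b i j * y j)
      (Measure.pi fun _ => gaussianReal 0 1) (Measure.pi fun _ => gaussianReal 0 1) := by
  refine ⟨by fun_prop, ?_⟩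
  have h0 := map_pi_eq_stdGaussian (ι := Fin n)
  have h1 := stdGaussian_map b.repr
  have h2 : (stdGaussian (EuclideanSpace ℝ (Fin n))).map (WithLp.ofLp) =
      Measure.pi fun _ => gaussianReal 0 1 := by
    rw [← h0, Measure.map_map (by fun_prop) (by fun_prop)]
    exact Measure.map_id
  have hm : Measurable b.repr := b.repr.continuous.measurable
  conv_rhs => rw [← h2, ← h1, ← h0, Measure.map_map (by fun_prop) (by fun_prop),
    Measure.map_map (by fun_prop) (by fun_prop)]
  congr 1
  ext y i
  simp [b.repr_apply_apply, PiLp.inner_apply, mul_comm]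

lemma rot_pres {n : ℕ} (d : ℕ) (b : OrthonormalBasis (Fin n) ℝ (EuclideanSpace ℝ (Fin n))) :
    MeasurePreserving (rotSample d b) (stdGaussianSample n d) (stdGaussianSample n d) := by
  have h : MeasurePreserving (fun (y : Fin d → Fin n → ℝ) (k : Fin d) (i : Fin n) =>
      ∑ j, b i j * y k j) (stdGaussianSample d n) (stdGaussianSample d n) :=
    measurePreserving_pi _ _ (fun _ => rot_one b)
  exact (swap_aux d n).comp (h.comp (swap_aux n d))

lemma rot_scatter {n : ℕ} (d : ℕ) (b : OrthonormalBasis (Fin n) ℝ (EuclideanSpace ℝ (Fin n)))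
    (Y : Fin n → Fin d → ℝ) (k l : Fin d) :
    ∑ i, rotSample d b Y i k * rotSample d b Y i l = ∑ i, Y i k * Y i l := by
  have h := b.sum_inner_mul_inner (WithLp.toLp 2 fun i => Y i k) (WithLp.toLp 2 fun i => Y i l)
  simpa [PiLp.inner_apply, rotSample, mul_comm] using h

lemma exists_basis (m : ℕ) : ∃ b : OrthonormalBasis (Fin (m+1)) ℝ (EuclideanSpace ℝ (Fin (m+1))),
    ∀ j, b 0 j = (√(m+1 : ℝ))⁻¹ := by
  have hv : Orthonormal ℝ (({0} : Set (Fin (m+1))).domRestrict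
      (fun _ => WithLp.toLp 2 (fun _ : Fin (m+1) => (√(m+1 : ℝ))⁻¹))) := by
    refine ⟨fun i => ?_, fun i j hij => (hij (Subsingleton.elim _ _)).elim⟩
    have hp : (0:ℝ) < m + 1 := by positivity
    simp [EuclideanSpace.norm_eq, Real.sq_sqrt hp.le, hp.ne']
  obtain ⟨b, hb⟩ := hv.exists_orthonormalBasis_extension_of_card_eq (by simp)
  exact ⟨b, fun j => by rw [hb 0 rfl]⟩

lemma mean_eq {m : ℕ} (d : ℕ)
    (b : OrthonormalBasis (Fin (m+1)) ℝ (EuclideanSpace ℝ (Fin (m+1))))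
    (hb : ∀ j, b 0 j = (√(m+1 : ℝ))⁻¹) (Y : Fin (m+1) → Fin d → ℝ) :
    sampleMean (m+1) d Y = (√(m+1 : ℝ))⁻¹ • rotSample d b Y 0 := by
  ext k
  have hp : (0:ℝ) < m + 1 := by positivity
  simp only [sampleMean, rotSample, hb, Pi.smul_apply, Finset.sum_apply, smul_eq_mul,
    ← Finset.mul_sum, ← mul_assoc, ← mul_inv, Real.mul_self_sqrt hp.le]
  push_cast
  rfl

lemma scatter_eq {m : ℕ} (d : ℕ)
    (b : OrthonormalBasis (Fin (m+1)) ℝ (EuclideanSpace ℝ (Fin (m+1))))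
    (hb : ∀ j, b 0 j = (√(m+1 : ℝ))⁻¹) (Y : Fin (m+1) → Fin d → ℝ) :
    centeredScatter (m+1) d Y =
      ∑ i : Fin m, vecMulVec (rotSample d b Y i.succ) (rotSample d b Y i.succ) := by
  ext k l
  have hp : (0:ℝ) < m + 1 := by positivity
  have h := rot_scatter d b Y k l
  rw [Fin.sum_univ_succ] at h
  have hs : ∀ k, ∑ i, Y i k = (m+1 : ℝ) * sampleMean (m+1) d Y k := by
    intro k
    simp only [sampleMean, Pi.smul_apply, Finset.sum_apply, smul_eq_mul]
    push_cast
    field_simp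
  have hm : ∀ k, rotSample d b Y 0 k = √(m+1 : ℝ) * sampleMean (m+1) d Y k := by
    intro k
    rw [mean_eq d b hb]
    have : √(m+1 : ℝ) ≠ 0 := (Real.sqrt_pos.2 hp).ne'
    simp [this]
  have h2 := Real.mul_self_sqrt hp.le
  simp only [centeredScatter, Matrix.sum_apply, vecMulVec_apply, Pi.sub_apply]
  rw [hm, hm] at h
  have e : ∑ i, (Y i k - sampleMean (m+1) d Y k) * (Y i l - sampleMean (m+1) d Y l)
      = ∑ i, Y i k * Y i l - (m+1) * (sampleMean (m+1) d Y k * sampleMean (m+1) d Y l) := by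
    simp only [sub_mul, mul_sub, Finset.sum_sub_distrib, ← Finset.mul_sum, ← Finset.sum_mul, hs]
    simp
    ring
  rw [e, ← h]
  linear_combination (sampleMean (m+1) d Y k * sampleMean (m+1) d Y l) * h2

theorem centered_scatter_wishart_and_indep (d n : ℕ) (hd : 1 ≤ d) (hn : 2 ≤ n) :
    Measure.map (centeredScatter n d) (stdGaussianSample n d)
        = Measure.map (fun Z : Fin (n - 1) → Fin d → ℝ =>
            ∑ i : Fin (n - 1), vecMulVec (Z i) (Z i)) (stdGaussianSample (n - 1) d) ∧
      IndepFun (centeredScatter n d) (sampleMean n d) (stdGaussianSample n d) := by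
  obtain ⟨m, rfl⟩ : ∃ m, n = m + 1 := ⟨n - 1, by omega⟩
  obtain ⟨b, hb⟩ := exists_basis m
  have : ∀ n, IsProbabilityMeasure (stdGaussianSample n d) := fun n => by
    unfold stdGaussianSample; infer_instance
  let γ : Measure (Fin d → ℝ) := Measure.pi fun _ => gaussianReal 0 1
  have hsplit : MeasurePreserving
      (fun Y : Fin (m+1) → Fin d → ℝ => (rotSample d b Y 0, fun i : Fin m => rotSample d b Y i.succ))
      (stdGaussianSample (m+1) d) (γ.prod (stdGaussianSample m d)) :=
    (measurePreserving_piFinSuccAbove (fun _ : Fin (m+1) => γ) 0).comp (rot_pres d b)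
  let F : (Fin m → Fin d → ℝ) → Matrix (Fin d) (Fin d) ℝ :=
    fun Z => ∑ i : Fin m, vecMulVec (Z i) (Z i)
  let G : (Fin d → ℝ) → (Fin d → ℝ) := fun z => (√(m+1 : ℝ))⁻¹ • z
  have hF : Measurable F := by
    refine measurable_pi_lambda _ fun k => measurable_pi_lambda _ fun l => ?_
    simp only [F, Matrix.sum_apply, vecMulVec_apply]
    fun_prop
  have hG : Measurable G := by fun_prop
  have hW : centeredScatter (m+1) d = (F ∘ Prod.snd) ∘
      (fun Y : Fin (m+1) → Fin d → ℝ =>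
        (rotSample d b Y 0, fun i : Fin m => rotSample d b Y i.succ)) := by
    funext Y; exact scatter_eq d b hb Y
  have hM : sampleMean (m+1) d = (G ∘ Prod.fst) ∘
      (fun Y : Fin (m+1) → Fin d → ℝ =>
        (rotSample d b Y 0, fun i : Fin m => rotSample d b Y i.succ)) := by
    funext Y; exact mean_eq d b hb Y
  have hFm : Measurable (F ∘ (Prod.snd : (Fin d → ℝ) × _ → _)) := hF.comp measurable_snd
  have hGm : Measurable (G ∘ (Prod.fst : _ × (Fin m → Fin d → ℝ) → _)) := hG.comp measurable_fst
  rw [hW, hM]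
  constructor
  · rw [← Measure.map_map hFm hsplit.measurable, hsplit.map_eq,
      ← Measure.map_map hF measurable_snd, ← Measure.snd, Measure.snd_prod]
    rfl
  · have hi : IndepFun (F ∘ Prod.snd) (G ∘ Prod.fst) (γ.prod (stdGaussianSample m d)) :=
      (indepFun_prod (μ := γ) (ν := stdGaussianSample m d) hG hF).symm
    rw [← hsplit.map_eq] at hi
    rw [indepFun_iff_measure_inter_preimage_eq_mul] at hi ⊢
    intro s t hs ht
    have h := hi s t hs ht
    rw [Measure.map_apply hsplit.measurable ((hFm hs).inter (hGm ht)),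
      Measure.map_apply hsplit.measurable (hFm hs),
      Measure.map_apply hsplit.measurable (hGm ht)] at h
    exact h
end

section
/- For every real u > 0, the trigamma series admits the Laplace-transform representation ∑_{k=0}^∞ 1/(u+k)² = ∫_0^∞ t·e^{−ut}/(1 − e^{−t}) dt, where the integral on the right is absolutely convergent. -/
open MeasureTheory

lemma tri_integral (r : ℝ) (hr : 0 < r) :
    ∫ t in Set.Ioi (0 : ℝ), t * Real.exp (-r * t) = 1 / r ^ 2 := by
  have key := Real.integral_rpow_mul_exp_neg_mul_Ioi (a := 2) two_pos hr
  have h1 : (2 : ℝ) - 1 = 1 := by norm_num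
  simp only [h1, Real.rpow_one, Real.Gamma_two, mul_one, Real.rpow_two] at key
  simp only [neg_mul]
  rw [key]
  simp

lemma tri_integrable (r : ℝ) (hr : 0 < r) :
    IntegrableOn (fun t : ℝ => t * Real.exp (-r * t)) (Set.Ioi 0) := by
  refine Integrable.of_integral_ne_zero ?_
  rw [tri_integral r hr]
  positivity

theorem trigamma_laplace_representation (u : ℝ) (hu : 0 < u) :
    (∑' k : ℕ, 1 / (u + k) ^ 2)
        = ∫ t in Set.Ioi (0 : ℝ), t * Real.exp (-u * t) / (1 - Real.exp (-t)) ∧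
      IntegrableOn (fun t : ℝ => t * Real.exp (-u * t) / (1 - Real.exp (-t)))
        (Set.Ioi 0) := by
  have hk : ∀ k : ℕ, 0 < u + k := fun k => by positivity
  constructor
  · have hs : Summable (fun k : ℕ => 1 / (u + k) ^ 2) := by
      have := (Real.summable_one_div_nat_add_rpow u 2).2 (by norm_num)
      refine this.congr fun k => ?_
      rw [Real.rpow_two, sq_abs, add_comm]
    have h := hasSum_integral_of_summable_integral_norm
      (μ := volume.restrict (Set.Ioi (0 : ℝ)))
      (F := fun (k : ℕ) (t : ℝ) => t * Real.exp (-(u + k) * t))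
      (fun k => tri_integrable _ (hk k)) (by
        refine hs.congr fun k => ?_
        rw [← tri_integral _ (hk k)]
        refine (setIntegral_congr_fun measurableSet_Ioi fun t ht => ?_)
        have ht : 0 < t := ht
        exact (Real.norm_of_nonneg (by positivity)).symm)
    have h2 := h.tsum_eq
    simp only [tri_integral _ (hk _)] at h2
    rw [h2]
    refine setIntegral_congr_fun measurableSet_Ioi fun t ht => ?_
    have ht : 0 < t := ht
    have hg := (hasSum_geometric_of_lt_one (Real.exp_pos (-t)).le
      (Real.exp_lt_one_iff.2 (by linarith))).mul_left (t * Real.exp (-u * t))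
    have he := hg.tsum_eq
    beta_reduce
    rw [div_eq_mul_inv, ← he]
    refine tsum_congr fun k => ?_
    rw [← Real.exp_nat_mul, mul_assoc, ← Real.exp_add]
    ring_nf
  · have hb : IntegrableOn (fun t : ℝ => Real.exp (-u * t) + t * Real.exp (-u * t))
        (Set.Ioi 0) := (exp_neg_integrableOn_Ioi 0 hu).add (tri_integrable u hu)
    refine Integrable.mono' hb (by
      apply Measurable.aestronglyMeasurable
      fun_prop) ?_
    filter_upwards [ae_restrict_mem measurableSet_Ioi] with t ht
    have ht : 0 < t := ht
    have h1 : Real.exp (-t) < 1 := Real.exp_lt_one_iff.2 (by linarith)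
    have h2 : 0 < 1 - Real.exp (-t) := by linarith
    rw [Real.norm_of_nonneg (by positivity), div_le_iff₀ h2]
    have h3 : t + 1 ≤ Real.exp t := Real.add_one_le_exp t
    have h4 : (1 + t) * Real.exp (-t) ≤ 1 := by
      calc (1 + t) * Real.exp (-t) ≤ Real.exp t * Real.exp (-t) := by
            gcongr; linarith
        _ = 1 := by rw [← Real.exp_add]; simp
    have h5 : t ≤ (1 + t) * (1 - Real.exp (-t)) := by linarith
    calc t * Real.exp (-u * t) ≤ ((1 + t) * (1 - Real.exp (-t))) * Real.exp (-u * t) := by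
          gcongr
      _ = _ := by ring
end

section
/- For every integer d ≥ 1 and every real t > 0, the kernel B_d(t) := d + d(d+1)·t·e^{(d+1)t} − (2t/(1 − e^{−2t}))·((e^{dt} − 1)/(e^{t} − 1)) is strictly positive: B_d(t) > 0. -/
lemma exp_le_aux (x : ℝ) : Real.exp x ≤ 1 + x * Real.exp x := by
  have h := Real.add_one_le_exp (-x)
  have h2 : Real.exp (-x) * Real.exp x = 1 := by rw [← Real.exp_add]; simp
  nlinarith [Real.exp_pos x]

lemma geom_aux (t : ℝ) (ht : 0 < t) (d : ℕ) :
    (1 + 2 * t) * (∑ k ∈ Finset.range d, Real.exp t ^ k)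
      ≤ d + t * (d * (d + 3) / 2) * Real.exp (d * t) := by
  induction d with
  | zero => simp
  | succ d ih =>
    rw [Finset.sum_range_succ, ← Real.exp_nat_mul]
    have h1 := exp_le_aux (d * t)
    have h2 : Real.exp (d * t) ≤ Real.exp ((d + 1) * t) := Real.exp_le_exp.2 (by nlinarith)
    have h3 : 0 ≤ t * (((d : ℝ) + 1) * (d + 4) / 2) := by positivity
    have h4 := mul_le_mul_of_nonneg_left h2 h3
    push_cast
    nlinarith

theorem kernel_Bd_pos (d : ℕ) (hd : 1 ≤ d) (t : ℝ) (ht : 0 < t) :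
    0 < (d : ℝ) + d * (d + 1) * t * Real.exp ((d + 1) * t)
        - (2 * t / (1 - Real.exp (-2 * t)))
          * ((Real.exp (d * t) - 1) / (Real.exp t - 1)) := by
  have he : Real.exp t ≠ 1 := by
    have := Real.add_one_lt_exp ht.ne'
    intro h; linarith
  rw [Real.exp_nat_mul, ← geom_sum_eq he]
  have hp : 0 < 1 - Real.exp (-2 * t) := by
    have : Real.exp (-2 * t) < 1 := Real.exp_lt_one_iff.2 (by linarith)
    linarith
  have hq : 2 * t / (1 - Real.exp (-2 * t)) ≤ 1 + 2 * t := by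
    rw [div_le_iff₀ hp]
    have := exp_le_aux (-2 * t)
    nlinarith
  have hS : 0 ≤ ∑ k ∈ Finset.range d, Real.exp t ^ k :=
    Finset.sum_nonneg fun k _ => by positivity
  have h1 := mul_le_mul_of_nonneg_right hq hS
  have h2 := geom_aux t ht d
  have h3 : Real.exp (d * t) < Real.exp ((d + 1) * t) := Real.exp_lt_exp.2 (by nlinarith)
  have hd1 : (1 : ℝ) ≤ d := by exact_mod_cast hd
  have h4 : t * (d * (d + 3) / 2) ≤ d * (d + 1) * t := by
    have : 0 ≤ t * d * ((d : ℝ) - 1) := mul_nonneg (by positivity) (by linarith)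
    nlinarith
  have h5 : t * (d * (d + 3) / 2) * Real.exp (d * t)
      < d * (d + 1) * t * Real.exp ((d + 1) * t) :=
    mul_lt_mul' h4 h3 (Real.exp_pos _).le (by positivity)
  linarith
end
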